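/- arXiv:2604.13189 — 3 statements merged into one kernel-verified Lean document; each statement's English description precedes it below -/
import Mathlib

section
/- If (X,T) is a surjective topological dynamical system with the partial shadowing property, then (X,T) is chain transitive. -/
open Filter Finset
open scoped Classical

/-- The finite sequence `(x_i)_{i=0}^r` (with `r ≥ 1`) is a `δ`-partial pseudo-orbit for `T`. -/
def IsPartialPseudoOrbit {X : Type*} [MetricSpace X] (T : X → X) (δ : ℝ) (r : ℕ)
    (x : ℕ → X) : Prop :=
  1 ≤ r ∧ 1 - δ <
    (((Finset.range r).filter (fun i => dist (T (x i)) (x (i + 1)) < δ)).card : ℝ) / (r : ℝ)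

/-- The finite sequence `(x_i)_{i=0}^r` is `ε`-partially traced by `z`. -/
def PartiallyTraces {X : Type*} [MetricSpace X] (T : X → X) (ε : ℝ) (r : ℕ)
    (x : ℕ → X) (z : X) : Prop :=
  1 - ε <
    (((Finset.range (r + 1)).filter (fun i => dist (T^[i] z) (x i) < ε)).card : ℝ) / ((r : ℝ) + 1)

/-- `(X,T)` has the partial shadowing property. -/
def PartialShadowing {X : Type*} [MetricSpace X] (T : X → X) : Prop :=
  ∀ ε > (0 : ℝ), ∃ δ > (0 : ℝ), ∀ (r : ℕ) (x : ℕ → X),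
    IsPartialPseudoOrbit T δ r x → ∃ z : X, PartiallyTraces T ε r x z

/-- `(c_i)_{i=0}^{n-1}` is a `δ`-chain: `ρ(T(c_i), c_{i+1}) < δ` for all `0 ≤ i ≤ n - 2`. -/
def IsDeltaChain {X : Type*} [MetricSpace X] (T : X → X) (δ : ℝ) (n : ℕ) (c : ℕ → X) : Prop :=
  ∀ i : ℕ, i + 2 ≤ n → dist (T (c i)) (c (i + 1)) < δ

/-- `(X,T)` is chain transitive: for every `δ > 0` and every `x, y ∈ X` there are `n ≥ 1`
and a `δ`-chain `(c_i)_{i=0}^{n-1}` with `c_0 = x` and `c_{n-1} = y`. -/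
def ChainTransitive {X : Type*} [MetricSpace X] (T : X → X) : Prop :=
  ∀ δ > (0 : ℝ), ∀ x y : X, ∃ n : ℕ, 1 ≤ n ∧
    ∃ c : ℕ → X, c 0 = x ∧ c (n - 1) = y ∧ IsDeltaChain T δ n c

/-- A surjective map admits a backward orbit from every point. -/
theorem exists_backward_orbit {X : Type*} {T : X → X} (hsurj : Function.Surjective T) (y : X) :
    ∃ b : ℕ → X, b 0 = y ∧ ∀ k, T (b (k + 1)) = b k := by
  choose g hg using hsurj
  refine ⟨fun k => g^[k] y, rfl, fun k => ?_⟩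
  simp only [Function.iterate_succ_apply', hg]

/-- A sequence with a single jump is a `δ`-partial pseudo-orbit once it is long enough. -/
theorem isPartialPseudoOrbit_of_forall_ne {X : Type*} [MetricSpace X] {T : X → X} {δ : ℝ}
    (hδ : 0 < δ) {r m : ℕ} (hr : 1 < δ * r) {w : ℕ → X}
    (hw : ∀ k < r, k ≠ m → T (w k) = w (k + 1)) : IsPartialPseudoOrbit T δ r w := by
  have hr0 : 0 < r := by
    rcases Nat.eq_zero_or_pos r with rfl | h
    · norm_num at hr
    · exact h
  refine ⟨hr0, ?_⟩
  have hsub : (Finset.range r).erase m ⊆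
      (Finset.range r).filter (fun i => dist (T (w i)) (w (i + 1)) < δ) := by
    intro k hk
    rw [Finset.mem_erase, Finset.mem_range] at hk
    rw [Finset.mem_filter, Finset.mem_range, hw k hk.2 hk.1, dist_self]
    exact ⟨hk.2, hδ⟩
  have hcard := (Finset.pred_card_le_card_erase (s := Finset.range r) (a := m)).trans
    (Finset.card_le_card hsub)
  rw [Finset.card_range] at hcard
  have hcard' : (r : ℝ) ≤
      (((Finset.range r).filter (fun i => dist (T (w i)) (w (i + 1)) < δ)).card : ℝ) + 1 := by
    exact_mod_cast (by omega : r ≤ _ + 1)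
  rw [lt_div_iff₀ (by exact_mod_cast hr0)]
  linarith

/-- A point that `ε`-partially traces a sequence is `ε`-close to it at some time in any set of
times of proportion at least `ε`. -/
theorem PartiallyTraces.exists_mem_dist_lt {X : Type*} [MetricSpace X] {T : X → X} {ε : ℝ}
    {r : ℕ} {w : ℕ → X} {z : X} (hz : PartiallyTraces T ε r w z) {S : Finset ℕ}
    (hS : S ⊆ Finset.range (r + 1)) (hcard : ε * (r + 1) ≤ S.card) :
    ∃ i ∈ S, dist (T^[i] z) (w i) < ε := by
  by_contra! hfar
  have hsub : (Finset.range (r + 1)).filter (fun i => dist (T^[i] z) (w i) < ε) ⊆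
      Finset.range (r + 1) \ S := by
    intro k hk
    rw [Finset.mem_filter] at hk
    exact Finset.mem_sdiff.2 ⟨hk.1, fun hkS => (hfar k hkS).not_gt hk.2⟩
  have hle := Finset.card_le_card hsub
  have hadd := Finset.card_sdiff_add_card_eq_card hS
  rw [Finset.card_range] at hadd
  have hle' : (((Finset.range (r + 1)).filter (fun i => dist (T^[i] z) (w i) < ε)).card : ℝ)
      + S.card ≤ (r : ℝ) + 1 := by
    exact_mod_cast (by omega : _ + S.card ≤ r + 1)
  unfold PartiallyTraces at hz
  rw [lt_div_iff₀ (by positivity)] at hz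
  linarith

theorem stmt2 {X : Type*} [MetricSpace X] [CompactSpace X] (T : X → X) (hT : Continuous T)
    (hsurj : Function.Surjective T) (h : PartialShadowing T) : ChainTransitive T := by
  intro η hη x y
  have hε : 0 < min η (1 / 4) := lt_min hη (by norm_num)
  obtain ⟨δ, hδ, hshadow⟩ := h _ hε
  obtain ⟨b, hb0, hb⟩ := exists_backward_orbit hsurj y
  obtain ⟨N, hN⟩ := exists_nat_gt (1 / δ)
  rw [div_lt_iff₀ hδ] at hN
  set n := N + 3 with hn
  set w : ℕ → X := fun k => if k < n then T^[k] x else b (2 * n - k) with hw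
  have hstep : ∀ k < 2 * n, k ≠ n - 1 → T (w k) = w (k + 1) := by
    intro k hk hkn
    simp only [hw]
    by_cases hlt : k < n
    · rw [if_pos hlt, if_pos (by omega), Function.iterate_succ_apply']
    · rw [if_neg hlt, if_neg (by omega), ← hb (2 * n - (k + 1))]
      congr 2
      omega
  obtain ⟨z, hz⟩ := hshadow (2 * n) w <| isPartialPseudoOrbit_of_forall_ne hδ
    (by push_cast [hn]; nlinarith [Nat.cast_nonneg (α := ℝ) N]) hstep
  have hfrac : min η (1 / 4) * (((2 * n : ℕ) : ℝ) + 1) ≤ ((n - 1 : ℕ) : ℝ) := by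
    refine (mul_le_mul_of_nonneg_right (min_le_right _ _) (by positivity)).trans ?_
    have : n - 1 = N + 2 := by omega
    rw [this]
    push_cast [hn]
    linarith [Nat.cast_nonneg (α := ℝ) N]
  obtain ⟨i, hi, hiz⟩ := hz.exists_mem_dist_lt (S := Finset.Ico 1 n)
    (fun k hk => by rw [Finset.mem_Ico] at hk; rw [Finset.mem_range]; omega)
    (by rwa [Nat.card_Ico])
  obtain ⟨j, hj, hjz⟩ := hz.exists_mem_dist_lt (S := Finset.Ico n (2 * n + 1))
    (fun k hk => by rw [Finset.mem_Ico] at hk; rw [Finset.mem_range]; omega)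
    (by rw [Nat.card_Ico]; exact hfrac.trans (by exact_mod_cast (by omega)))
  rw [Finset.mem_Ico] at hi hj
  refine ⟨2 * n + 1, by omega, fun k => if i ≤ k ∧ k < j then T^[k] z else w k, ?_, ?_, ?_⟩
  · beta_reduce
    rw [if_neg (by omega)]
    simp [hw, hn]
  · beta_reduce
    rw [if_neg (by omega)]
    simp only [hw]
    rw [if_neg (by omega), ← hb0]
    congr 1
    omega
  · intro k hk
    beta_reduce
    by_cases hk1 : i ≤ k ∧ k < j <;> by_cases hk2 : i ≤ k + 1 ∧ k + 1 < j
    · rw [if_pos hk1, if_pos hk2, Function.iterate_succ_apply', dist_self]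
      exact hη
    · obtain rfl : k + 1 = j := by omega
      rw [if_pos hk1, if_neg hk2, ← Function.iterate_succ_apply' T]
      exact hjz.trans_le (min_le_left _ _)
    · obtain rfl : k + 1 = i := by omega
      rw [if_neg hk1, if_pos hk2, hstep k (by omega) (by omega), dist_comm]
      exact hiz.trans_le (min_le_left _ _)
    · rw [if_neg hk1, if_neg hk2, hstep k (by omega) (by omega), dist_self]
      exact hη
end

section
/- If (X,T) is a surjective topological dynamical system with the partial shadowing property, then (X,T) is chain mixing. -/
open Filter Finset
open scoped Classical

/-- `(X,T)` is chain mixing: for every `δ > 0` there is `M` such that for every `x, y ∈ X`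
and all `n ≥ M` there is a `δ`-chain `(c_i)_{i=0}^{n-1}` with `c_0 = x` and `c_{n-1} = y`. -/
def ChainMixing {X : Type*} [MetricSpace X] (T : X → X) : Prop :=
  ∀ δ > (0 : ℝ), ∃ M : ℕ, ∀ x y : X, ∀ n : ℕ, M ≤ n →
    ∃ c : ℕ → X, c 0 = x ∧ c (n - 1) = y ∧ IsDeltaChain T δ n c

/-- Two orbit pieces glued at one place form a partial pseudo-orbit once they are long enough. -/
lemma isPartialPseudoOrbit_of_single_jump {X : Type*} [MetricSpace X] (T : X → X) {δ : ℝ}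
    (hδ : 0 < δ) {r : ℕ} (hr : 1 ≤ r) (hrδ : 1 < r * δ) (k : ℕ) (s : ℕ → X)
    (hs : ∀ i < r, i + 1 ≠ k → T (s i) = s (i + 1)) : IsPartialPseudoOrbit T δ r s := by
  refine ⟨hr, ?_⟩
  have hsub : (range r).erase (k - 1) ⊆
      (range r).filter (fun i => dist (T (s i)) (s (i + 1)) < δ) := by
    intro i hi
    simp only [mem_erase, mem_range, mem_filter] at hi ⊢
    refine ⟨hi.2, ?_⟩
    rw [hs i hi.2 (by omega), dist_self]
    exact hδ
  have hcard := (pred_card_le_card_erase (s := range r) (a := k - 1)).trans (card_le_card hsub)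
  rw [card_range] at hcard
  have hcard' : (r : ℝ) ≤
      ((range r).filter (fun i => dist (T (s i)) (s (i + 1)) < δ)).card + 1 := by
    exact_mod_cast (by omega : r ≤ _ + 1)
  have hr0 : (0 : ℝ) < r := by exact_mod_cast hr
  rw [lt_div_iff₀ hr0]
  linarith

/-- If fewer than two thirds of the indices lie in `A`, a tracing point is close to the sequence at
some index outside `A`. -/
lemma PartiallyTraces.exists_dist_lt {X : Type*} [MetricSpace X] {T : X → X} {ε : ℝ}
    {r : ℕ} {s : ℕ → X} {z : X} (h : PartiallyTraces T ε r s z) (hε : ε ≤ 1 / 3)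
    (A : Finset ℕ) (hA : 3 * A.card ≤ 2 * (r + 1)) :
    ∃ i ≤ r, i ∉ A ∧ dist (T^[i] z) (s i) < ε := by
  by_contra! hcon
  have hsub : (range (r + 1)).filter (fun i => dist (T^[i] z) (s i) < ε) ⊆ A := by
    intro i hi
    simp only [mem_filter, mem_range] at hi
    by_contra hiA
    exact absurd hi.2 (not_lt.2 (hcon i (by omega) hiA))
  have hcard : ((((range (r + 1)).filter (fun i => dist (T^[i] z) (s i) < ε)).card : ℕ) : ℝ)
      ≤ A.card := by exact_mod_cast card_le_card hsub
  have hA' : (3 : ℝ) * A.card ≤ 2 * (r + 1) := by exact_mod_cast hA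
  have hr : (0 : ℝ) < (r : ℝ) + 1 := by positivity
  have hgood := h
  rw [PartiallyTraces, lt_div_iff₀ hr] at hgood
  nlinarith

theorem stmt3 {X : Type*} [MetricSpace X] [CompactSpace X] (T : X → X) (hT : Continuous T)
    (hsurj : Function.Surjective T) (h : PartialShadowing T) : ChainMixing T := by
  intro ε hε
  obtain ⟨δ, hδ, hshadow⟩ := h (min ε (1 / 3)) (by positivity)
  obtain ⟨N, hN⟩ := exists_nat_gt (1 / δ)
  refine ⟨N + 10, fun x y n hn => ?_⟩
  obtain ⟨S, hS⟩ := hsurj.hasRightInverse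
  obtain ⟨r, rfl⟩ : ∃ r, n = r + 1 := ⟨n - 1, by omega⟩
  obtain ⟨k, hk⟩ : ∃ k, k = (r + 1) / 2 := ⟨_, rfl⟩
  have hback : ∀ m < r, T (S^[r - m] y) = S^[r - (m + 1)] y := by
    intro m hm
    rw [show r - m = (r - (m + 1)) + 1 by omega, Function.iterate_succ_apply', hS]
  have hforw : ∀ (m : ℕ) (u : X), T (T^[m] u) = T^[m + 1] u := fun m u =>
    (Function.iterate_succ_apply' T m u).symm
  have hrδ : 1 < r * δ := by
    have hNr : (N : ℝ) ≤ r := by exact_mod_cast (by omega : N ≤ r)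
    rw [div_lt_iff₀ hδ] at hN
    nlinarith
  obtain ⟨z, hz⟩ := hshadow r (fun m => if m < k then T^[m] x else S^[r - m] y)
    (isPartialPseudoOrbit_of_single_jump T hδ (by omega) hrδ k _ (by
      intro i hi hik
      by_cases hlt : i < k
      · simp only [if_pos hlt, if_pos (show i + 1 < k by omega), hforw]
      · simp only [if_neg hlt, if_neg (show ¬ i + 1 < k by omega), hback i hi]))
  obtain ⟨i, hir, hiA, hi⟩ := hz.exists_dist_lt (min_le_right _ _) (insert 0 (Icc k r)) (by
    have := card_insert_le 0 (Icc k r)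
    rw [Nat.card_Icc] at this
    omega)
  obtain ⟨j, hjr, hjA, hj⟩ := hz.exists_dist_lt (min_le_right _ _) (range k) (by
    rw [card_range]
    omega)
  simp only [mem_insert, mem_Icc, mem_range] at hiA hjA
  have hik : i < k := by omega
  rw [if_pos hik] at hi
  rw [if_neg hjA] at hj
  replace hi := hi.trans_le (min_le_left _ _)
  replace hj := hj.trans_le (min_le_left _ _)
  refine ⟨fun m => if m < i then T^[m] x else if m < j then T^[m] z else S^[r - m] y, ?_, ?_, ?_⟩
  · simp [show 0 < i by omega]
  · simp [show ¬ r < i by omega, show ¬ r < j by omega]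
  · intro m hm
    rcases lt_trichotomy (m + 1) i with hmi | hmi | hmi
    · simpa only [if_pos hmi, if_pos (show m < i by omega), hforw, dist_self] using hε
    · simp only [if_neg (show ¬ m + 1 < i by omega), if_pos (show m < i by omega),
        if_pos (show m + 1 < j by omega), hforw]
      rw [hmi, dist_comm]
      exact hi
    · simp only [if_neg (show ¬ m + 1 < i by omega), if_neg (show ¬ m < i by omega)]
      rcases lt_trichotomy (m + 1) j with hmj | hmj | hmj
      · simpa only [if_pos hmj, if_pos (show m < j by omega), hforw, dist_self] using hε
      · simp only [if_neg (show ¬ m + 1 < j by omega), if_pos (show m < j by omega), hforw]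
        rw [hmj]
        exact hj
      · simpa only [if_neg (show ¬ m + 1 < j by omega), if_neg (show ¬ m < j by omega),
          hback m (by omega), dist_self] using hε
end

section
/- Let (X,T) be a surjective topological dynamical system that has both the shadowing property and the partial shadowing property. Then (X,T) has the specification property. -/
open Filter Finset
open scoped Classical

/-- `(X,T)` has the shadowing property: for every `ε > 0` there is `δ > 0` such that every
`δ`-pseudo-orbit is `ε`-traced by some point. -/
def Shadowing {X : Type*} [MetricSpace X] (T : X → X) : Prop :=
  ∀ ε > (0 : ℝ), ∃ δ > (0 : ℝ), ∀ x : ℕ → X,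
    (∀ i : ℕ, dist (T (x i)) (x (i + 1)) < δ) →
    ∃ z : X, ∀ i : ℕ, dist (T^[i] z) (x i) < ε

/-- `{T^{[a_i, b_i]}(x_i)}_{i=0}^{r-1}` is an `M`-spaced specification (closed orbit segments):
`a_0 < b_0 < a_1 < b_1 < … < a_{r-1} < b_{r-1}` and `a_{i+1} - b_i ≥ M`. -/
def IsSpacedSpec (M r : ℕ) (a b : ℕ → ℕ) : Prop :=
  (∀ i < r, a i < b i) ∧ ∀ i : ℕ, i + 1 < r → b i < a (i + 1) ∧ b i + M ≤ a (i + 1)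

/-- `(X,T)` has the specification property: for every `ε > 0` there is `M` such that every
`M`-spaced specification `{T^{[a_i, b_i]}(x_i)}_{i=0}^{r-1}` is `ε`-traced by some point `y`,
i.e. `ρ(T^j(x_i), T^j(y)) < ε` for all `i < r` and `a_i ≤ j ≤ b_i`. -/
def Specification {X : Type*} [MetricSpace X] (T : X → X) : Prop :=
  ∀ ε > (0 : ℝ), ∃ M : ℕ, ∀ r : ℕ, 1 ≤ r → ∀ (a b : ℕ → ℕ) (x : ℕ → X),
    IsSpacedSpec M r a b →
    ∃ y : X, ∀ i < r, ∀ j : ℕ, a i ≤ j → j ≤ b i → dist (T^[j] (x i)) (T^[j] y) < ε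

/-- A point in the first half and a point in the second half are traced by any partially tracing
point, provided at least three quarters of the times are traced. -/
theorem PartiallyTraces.exists_lt_exists_ge {X : Type*} [MetricSpace X] {T : X → X} {ε η : ℝ}
    {r : ℕ} (hr : 1 ≤ r) {x : ℕ → X} {z : X} (hη : η ≤ 1 / 4) (hηε : η ≤ ε)
    (h : PartiallyTraces T η r x z) :
    (∃ i < (r + 1) / 2, dist (T^[i] z) (x i) < ε) ∧
      ∃ j, (r + 1) / 2 ≤ j ∧ j ≤ r ∧ dist (T^[j] z) (x j) < ε := by
  have hcard : ∀ s : Finset ℕ, s.card ≤ r + 1 - (r + 1) / 2 →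
      (∀ i ∈ Finset.range (r + 1), dist (T^[i] z) (x i) < η → i ∈ s) → False := by
    intro s hs hsub
    have h1 : ((Finset.range (r + 1)).filter (fun i => dist (T^[i] z) (x i) < η)).card ≤ s.card :=
      Finset.card_le_card fun i hi => by
        rw [Finset.mem_filter] at hi
        exact hsub i hi.1 hi.2
    have h2 := h1.trans hs
    unfold PartiallyTraces at h
    rw [lt_div_iff₀ (by positivity)] at h
    have h3 : 3 * (r + 1) < 4 * (r + 1 - (r + 1) / 2) := by
      have h4 : (((Finset.range (r + 1)).filter
          (fun i => dist (T^[i] z) (x i) < η)).card : ℝ) ≤ ((r + 1 - (r + 1) / 2 : ℕ) : ℝ) := by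
        exact_mod_cast h2
      have h5 : (3 * (r + 1) : ℝ) < 4 * ((r + 1 - (r + 1) / 2 : ℕ) : ℝ) := by
        nlinarith [(Nat.cast_nonneg r : (0 : ℝ) ≤ r)]
      exact_mod_cast h5
    omega
  constructor
  · by_contra! hcon
    refine hcard (Finset.Ico ((r + 1) / 2) (r + 1)) (by simp) fun i hi hd => ?_
    rw [Finset.mem_range] at hi
    rw [Finset.mem_Ico]
    refine ⟨?_, hi⟩
    by_contra! hlt
    linarith [hcon i hlt]
  · by_contra! hcon
    refine hcard (Finset.range ((r + 1) / 2)) (by rw [Finset.card_range]; omega)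
      fun i hi hd => ?_
    rw [Finset.mem_range] at hi ⊢
    by_contra! hle
    linarith [hcon i hle (by omega)]

/-- Under partial shadowing a surjective system is uniformly chain mixing: any two points are
joined by chains of every sufficiently large length. -/
theorem PartialShadowing.exists_chain {X : Type*} [MetricSpace X] [CompactSpace X] {T : X → X}
    (hT : Continuous T) (hsurj : Function.Surjective T) (h : PartialShadowing T)
    {δ : ℝ} (hδ : 0 < δ) :
    ∃ N : ℕ, ∀ r ≥ N, ∀ x y : X, ∃ c : ℕ → X, c 0 = x ∧ (∀ j ≥ r, c j = T^[j - r] y) ∧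
      ∀ j, dist (T (c j)) (c (j + 1)) < δ := by
  obtain ⟨ε, hε, hTε⟩ := Metric.uniformContinuous_iff.1
    (CompactSpace.uniformContinuous_of_continuous hT) (δ / 2) (half_pos hδ)
  obtain ⟨κ, hκ, hpart⟩ := h (min (1 / 4) (min ε (δ / 2))) (by positivity)
  obtain ⟨N, hN⟩ := exists_nat_gt (1 / κ)
  refine ⟨N + 1, fun r hr x y => ?_⟩
  obtain ⟨v, hv⟩ := hsurj.iterate r y
  have hr1 : 1 ≤ r := by omega
  have hr0 : (0 : ℝ) < r := by exact_mod_cast hr1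
  have hpseudo : IsPartialPseudoOrbit T κ r
      (fun m => if m < (r + 1) / 2 then T^[m] x else T^[m] v) := by
    refine ⟨hr1, ?_⟩
    have hsub : (Finset.range r).erase ((r + 1) / 2 - 1) ⊆ (Finset.range r).filter (fun i =>
        dist (T ((fun m => if m < (r + 1) / 2 then T^[m] x else T^[m] v) i))
          ((fun m => if m < (r + 1) / 2 then T^[m] x else T^[m] v) (i + 1)) < κ) := by
      intro i hi
      rw [Finset.mem_erase] at hi
      refine Finset.mem_filter.2 ⟨hi.2, ?_⟩
      by_cases h1 : i < (r + 1) / 2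
      · have h2 : i + 1 < (r + 1) / 2 := by omega
        simpa only [h1, h2, if_true, ← Function.iterate_succ_apply', dist_self] using hκ
      · have h2 : ¬ i + 1 < (r + 1) / 2 := by omega
        simpa only [h1, h2, if_false, ← Function.iterate_succ_apply', dist_self] using hκ
    have hcard := Finset.pred_card_le_card_erase.trans (Finset.card_le_card hsub)
    rw [Finset.card_range] at hcard
    have hcard' := (Nat.cast_le (α := ℝ)).2 hcard
    rw [Nat.cast_sub hr1, Nat.cast_one] at hcard'
    rw [lt_div_iff₀ hr0]
    refine lt_of_lt_of_le ?_ hcard'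
    have hNr : (N : ℝ) < r := by exact_mod_cast hr
    have : 1 < r * κ := (div_lt_iff₀ hκ).1 (hN.trans hNr)
    linarith
  obtain ⟨z, hz⟩ := hpart r _ hpseudo
  obtain ⟨⟨i, hi, hdi⟩, j, hj, hjr, hdj⟩ :=
    hz.exists_lt_exists_ge hr1 (min_le_left _ _) (min_le_right _ _)
  simp only [hi, if_true] at hdi
  simp only [not_lt.2 hj, if_false] at hdj
  have hdi' : dist (T^[i + 1] x) (T^[i + 1] z) < δ / 2 := by
    rw [Function.iterate_succ_apply', Function.iterate_succ_apply', dist_comm]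
    exact hTε (hdi.trans_le (min_le_left _ _))
  have hdj' : dist (T^[j] z) (T^[j] v) < δ / 2 := hdj.trans_le (min_le_right _ _)
  refine ⟨fun m => if m ≤ i then T^[m] x else if m < j then T^[m] z else T^[m] v,
    by simp, fun m hm => ?_, fun m => ?_⟩
  · have h1 : ¬ m ≤ i := by omega
    have h2 : ¬ m < j := by omega
    simp only [h1, h2, if_false]
    rw [← hv, ← Function.iterate_add_apply, Nat.sub_add_cancel hm]
  · rcases lt_trichotomy m i with h1 | rfl | h1
    · have h2 : m ≤ i := h1.le
      have h3 : m + 1 ≤ i := h1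
      simpa only [h2, h3, if_true, ← Function.iterate_succ_apply', dist_self] using hδ
    · have h3 : ¬ m + 1 ≤ m := by omega
      simp only [le_refl, h3, if_true, if_false, ← Function.iterate_succ_apply']
      split_ifs with h4
      · linarith
      · have h5 : j = m + 1 := by omega
        subst h5
        linarith [dist_triangle (T^[m + 1] x) (T^[m + 1] z) (T^[m + 1] v)]
    · have h2 : ¬ m ≤ i := by omega
      have h3 : ¬ m + 1 ≤ i := by omega
      simp only [h2, h3, if_false]
      rcases lt_trichotomy (m + 1) j with h4 | rfl | h4
      · have h5 : m < j := by omega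
        simpa only [h4, h5, if_true, ← Function.iterate_succ_apply', dist_self] using hδ
      · have h5 : m < m + 1 := by omega
        simp only [h5, lt_irrefl, if_true, if_false, ← Function.iterate_succ_apply']
        linarith
      · have h5 : ¬ m < j := by omega
        have h6 : ¬ m + 1 < j := by omega
        simpa only [h5, h6, if_false, ← Function.iterate_succ_apply', dist_self] using hδ

/-- If all points are joined by `δ`-chains of every length at least `N`, then the segments of an
`N`-spaced specification lie on a common `δ`-pseudo-orbit. -/
theorem IsSpacedSpec.exists_pseudoOrbit {X : Type*} [MetricSpace X] {T : X → X} {δ : ℝ}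
    (hδ : 0 < δ) {N : ℕ}
    (hN : ∀ r ≥ N, ∀ x y : X, ∃ c : ℕ → X, c 0 = x ∧ (∀ j ≥ r, c j = T^[j - r] y) ∧
      ∀ j, dist (T (c j)) (c (j + 1)) < δ)
    {a b : ℕ → ℕ} (x : ℕ → X) (r : ℕ) (h : IsSpacedSpec N (r + 1) a b) :
    ∃ p : ℕ → X, (∀ j, dist (T (p j)) (p (j + 1)) < δ) ∧
      (∀ i < r + 1, ∀ j, a i ≤ j → j ≤ b i → p j = T^[j] (x i)) ∧
      ∀ j ≥ a r, p j = T^[j] (x r) := by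
  induction r with
  | zero =>
    refine ⟨fun j => T^[j] (x 0), fun j => ?_, fun i hi j _ _ => ?_, fun j _ => rfl⟩
    · simpa only [← Function.iterate_succ_apply', dist_self] using hδ
    · rw [Nat.lt_one_iff.1 hi]
  | succ r ih =>
    obtain ⟨p, hp, hseg, -⟩ := ih ⟨fun i hi => h.1 i (by omega), fun i hi => h.2 i (by omega)⟩
    obtain ⟨hlt, hgap⟩ := h.2 r (by omega)
    obtain ⟨c, hc0, hcy, hc⟩ := hN (a (r + 1) - b r) (by omega) (p (b r))
      (T^[a (r + 1)] (x (r + 1)))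
    have hmono : ∀ i ≤ r, b i ≤ b r := by
      intro i hi
      induction hi using Nat.decreasingInduction with
      | self => exact le_rfl
      | of_succ k hk ihk =>
        have h1 := (h.2 k (by omega)).1
        have h2 := h.1 (k + 1) (by omega)
        omega
    have hlast : ∀ j ≥ a (r + 1),
        (if j ≤ b r then p j else c (j - b r)) = T^[j] (x (r + 1)) := by
      intro j hj
      rw [if_neg (by omega), hcy _ (by omega), ← Function.iterate_add_apply]
      congr 2
      omega
    refine ⟨fun j => if j ≤ b r then p j else c (j - b r), fun j => ?_, fun i hi j hj hj' => ?_,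
      hlast⟩
    · rcases lt_trichotomy j (b r) with h1 | rfl | h1
      · have h2 : j ≤ b r := h1.le
        have h3 : j + 1 ≤ b r := h1
        simpa only [h2, h3, if_true] using hp j
      · have h3 : ¬ b r + 1 ≤ b r := by omega
        simpa only [le_refl, h3, if_true, if_false, Nat.add_sub_cancel_left, hc0] using hc 0
      · have h2 : ¬ j ≤ b r := by omega
        have h3 : ¬ j + 1 ≤ b r := by omega
        simpa only [h2, h3, if_false, Nat.sub_add_comm h1.le] using hc (j - b r)
    · rcases Nat.lt_succ_iff_lt_or_eq.1 hi with hi | rfl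
      · have h1 : j ≤ b r := hj'.trans (hmono i (by omega))
        simpa only [h1, if_true] using hseg i hi j hj hj'
      · exact hlast j hj

theorem stmt5 {X : Type*} [MetricSpace X] [CompactSpace X] (T : X → X) (hT : Continuous T)
    (hsurj : Function.Surjective T) (hshad : Shadowing T) (hpshad : PartialShadowing T) :
    Specification T := by
  intro ε hε
  obtain ⟨δ, hδ, hshadow⟩ := hshad ε hε
  obtain ⟨N, hN⟩ := hpshad.exists_chain hT hsurj hδ
  refine ⟨N, fun r hr a b x hspec => ?_⟩
  obtain ⟨r, rfl⟩ := Nat.exists_eq_add_of_le' hr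
  obtain ⟨p, hp, hseg, -⟩ := hspec.exists_pseudoOrbit hδ hN x
  obtain ⟨z, hz⟩ := hshadow p hp
  refine ⟨z, fun i hi j hj hj' => ?_⟩
  rw [← hseg i hi j hj hj', dist_comm]
  exact hz j
end
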